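/- Let H be a sparse numerical semigroup of genus g with odd Frobenius number ℓ_g = 2g - 2r - 1 such that g > 4r + 1 (so that, necessarily, every element of H smaller than ℓ_g is even). Then H = 2H' ∪ H_{2g-2r-1} = {2n : n ∈ H'} ∪ {m ∈ ℕ : m ≥ 2g - 2r}, where H' := {n ∈ ℕ : 2n ∈ H and 2n < ℓ_g} ∪ {n ∈ ℕ : 2n > ℓ_g} is a numerical semigroup of genus r. -/

import Mathlib

/-- `H` is a numerical semigroup of genus `g`: it contains `0`, is closed under
addition, and its complement in `ℕ` (the set of gaps) is finite with exactly
`g` elements. -/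
def IsNumericalSemigroupOfGenus (H : Set ℕ) (g : ℕ) : Prop :=
  0 ∈ H ∧ (∀ a ∈ H, ∀ b ∈ H, a + b ∈ H) ∧ Hᶜ.Finite ∧ Hᶜ.ncard = g

/-- The `i`-th gap `ℓ_i` of `H` (1-indexed): the `i`-th smallest element of `ℕ \ H`.
In particular, if `H` has genus `g`, then `gap H g` is the Frobenius number of `H`. -/
noncomputable def gap (H : Set ℕ) (i : ℕ) : ℕ :=
  Nat.nth (fun n => n ∉ H) (i - 1)

/-- A numerical semigroup `H` of genus `g` is sparse if any two subsequent gaps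
differ by at most `2`. -/
def IsSparse (H : Set ℕ) (g : ℕ) : Prop :=
  ∀ i, 1 ≤ i → i ≤ g - 1 → gap H (i + 1) - gap H i ≤ 2

/-- `D`, the number of double leaps of `H` (of genus `g`). -/
noncomputable def numDouble (H : Set ℕ) (g : ℕ) : ℕ :=
  {i : ℕ | 1 ≤ i ∧ i ≤ g - 1 ∧ gap H (i + 1) - gap H i = 2}.ncard

/-- `S`, the number of single leaps of `H` (of genus `g`). -/
noncomputable def numSingle (H : Set ℕ) (g : ℕ) : ℕ :=
  {i : ℕ | 1 ≤ i ∧ i ≤ g - 1 ∧ gap H (i + 1) - gap H i = 1}.ncard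

section

variable {H : Set ℕ}

/-- If `H` is closed under addition, misses the odd number `l`, has an odd element below `l` and no
two consecutive elements up to `l`, then it has at most `(l + 2) / 3` elements up to `l`. -/
theorem three_mul_card_le_of_odd_mem [DecidablePred (· ∈ H)]
    (hadd : ∀ a ∈ H, ∀ b ∈ H, a + b ∈ H) {l : ℕ} (hl : l ∉ H) (hlodd : l % 2 = 1)
    (hsp : ∀ x, x ∈ H → x + 1 ∈ H → l < x + 1)
    (hex : ∃ h, h ∈ H ∧ h % 2 = 1 ∧ h < l) :
    3 * ((Finset.range (l + 1)).filter (· ∈ H)).card ≤ l + 2 := by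
  classical
  obtain ⟨h, ⟨hh, hodd, hlt⟩, hmin⟩ : ∃ h, (h ∈ H ∧ h % 2 = 1 ∧ h < l) ∧
      ∀ x, x < h → x % 2 = 1 → x ∉ H := by
    refine ⟨Nat.find hex, Nat.find_spec hex, fun x hx hx2 hxH => ?_⟩
    have := (Nat.find_spec hex).2.2
    exact Nat.find_min hex hx ⟨hxH, hx2, by omega⟩
  -- `k` is the length of the run `l - 1, l - 3, …` of elements of `H`, and `n` the gap below it
  obtain ⟨k, n, rfl, hrun, hn1, hn0⟩ : ∃ k n, l = n + 2 * k ∧ (∀ j < k, n + 2 * j + 1 ∈ H) ∧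
      n - 1 ∉ H ∧ 1 ≤ n := by
    have hE : ∃ j, 2 * j + 1 ≤ l ∧ l - 1 - 2 * j ∉ H := by
      by_contra! hcon
      have hm : l - h ∈ H := by
        have := hcon ((h - 1) / 2) (by omega)
        rwa [show l - 1 - 2 * ((h - 1) / 2) = l - h by omega] at this
      have := hadd _ hh _ hm
      rw [show h + (l - h) = l by omega] at this
      exact hl this
    obtain ⟨hk1, hk2⟩ := Nat.find_spec hE
    refine ⟨Nat.find hE, l - 2 * Nat.find hE, by omega, fun j hj => ?_, ?_, by omega⟩
    · have hmem := Nat.find_min hE (m := Nat.find hE - 1 - j) (by omega)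
      have hmem : l - 1 - 2 * (Nat.find hE - 1 - j) ∈ H := by
        by_contra hc
        exact hmem ⟨by omega, hc⟩
      convert hmem using 1
      omega
    · rwa [show l - 2 * Nat.find hE - 1 = l - 1 - 2 * Nat.find hE by omega]
  have hgap : ∀ j ≤ k, n + 2 * j ∉ H := by
    intro j hj hc
    rcases hj.lt_or_eq with hj | rfl
    · have := hsp _ hc (hrun j hj)
      omega
    · exact hl hc
  have hnH : n ∉ H := hgap 0 (by omega)
  have hhn : h < n := by
    by_contra hc
    have := hgap ((h - n) / 2) (by omega)
    rw [show n + 2 * ((h - n) / 2) = h by omega] at this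
    exact this hh
  have hkh : 2 * k ≤ h := by
    by_contra hc
    have h1 := hadd _ hh _ (hrun 0 (by omega))
    have := hgap ((h + 1) / 2) (by omega)
    rw [show n + 2 * ((h + 1) / 2) = h + (n + 2 * 0 + 1) by omega] at this
    exact this h1
  have hsub : ∀ a ∈ H, ∀ j ≤ k, ∀ x, x + a = n + 2 * j → x ∉ H := by
    intro a ha j hj x hx hxH
    exact hgap j hj (hx ▸ hadd _ hxH _ ha)
  set A := (Finset.range (n + 1)).filter (· ∈ H) with hA
  have memA : ∀ x, x ∈ A ↔ x < n ∧ x ∈ H := by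
    intro x
    simp only [hA, Finset.mem_filter, Finset.mem_range]
    refine ⟨fun hx => ⟨?_, hx.2⟩, fun hx => ⟨by omega, hx.2⟩⟩
    have : x ≠ n := fun hc => hnH (hc ▸ hx.2)
    omega
  set φ : ℕ → ℕ := fun i => if h - 2 * i - 3 ∈ H then n - h + 2 * i + 4 else h - 2 * i - 2 with hφ
  have hφspec : ∀ i < k - 1, 1 ≤ φ i ∧ φ i < n ∧ φ i ∉ H ∧ φ i - 1 ∉ H ∧ n - φ i ∉ H := by
    intro i hi
    simp only [hφ]
    split_ifs with hc
    · refine ⟨by omega, by omega, hsub h hh (i + 2) (by omega) _ (by omega),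
        hsub _ hc 0 (by omega) _ (by omega), hmin _ (by omega) (by omega)⟩
    · refine ⟨by omega, by omega, hmin _ (by omega) (by omega), ?_,
        hsub h hh (i + 1) (by omega) _ (by omega)⟩
      rwa [show h - 2 * i - 2 - 1 = h - 2 * i - 3 by omega]
  have hφinj : Set.InjOn φ (Finset.range (k - 1) : Finset ℕ) := by
    intro i hi j hj hij
    simp only [Finset.coe_range, Set.mem_Iio] at hi hj
    simp only [hφ] at hij
    split_ifs at hij <;> omega
  have hB : (A.image (· + 1)).card = A.card :=
    Finset.card_image_of_injective _ (add_left_injective 1)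
  have hC : (A.image (n - ·)).card = A.card := by
    refine Finset.card_image_of_injOn fun x hx y hy hxy => ?_
    have := ((memA x).1 hx).1
    have := ((memA y).1 hy).1
    change n - x = n - y at hxy
    omega
  have hU : ((Finset.range (k - 1)).image φ).card = k - 1 := by
    rw [Finset.card_image_of_injOn hφinj, Finset.card_range]
  have dAB : Disjoint A (A.image (· + 1)) := by
    rw [Finset.disjoint_left]
    intro x hx hx'
    obtain ⟨y, hy, rfl⟩ := Finset.mem_image.1 hx'
    have := hsp y ((memA _).1 hy).2 ((memA _).1 hx).2
    have := ((memA _).1 hx).1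
    omega
  have dABC : Disjoint (A ∪ A.image (· + 1)) (A.image (n - ·)) := by
    rw [Finset.disjoint_left]
    intro x hx hx'
    obtain ⟨y, hy, rfl⟩ := Finset.mem_image.1 hx'
    obtain ⟨hyn, hyH⟩ := (memA _).1 hy
    rcases Finset.mem_union.1 hx with hx | hx
    · exact hsub y hyH 0 (by omega) _ (by omega) ((memA _).1 hx).2
    · obtain ⟨z, hz, hzy⟩ := Finset.mem_image.1 hx
      have := hadd _ hyH _ ((memA _).1 hz).2
      rw [show y + z = n - 1 by omega] at this
      exact hn1 this
  have dU : Disjoint ((A ∪ A.image (· + 1)) ∪ A.image (n - ·))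
      ((Finset.range (k - 1)).image φ) := by
    rw [Finset.disjoint_right]
    intro x hx hx'
    obtain ⟨i, hi, rfl⟩ := Finset.mem_image.1 hx
    obtain ⟨-, hlt', hx1, hx2, hx3⟩ := hφspec i (Finset.mem_range.1 hi)
    rcases Finset.mem_union.1 hx' with hx' | hx'
    · rcases Finset.mem_union.1 hx' with hx' | hx'
      · exact hx1 ((memA _).1 hx').2
      · obtain ⟨z, hz, hzy⟩ := Finset.mem_image.1 hx'
        rw [← hzy, Nat.add_sub_cancel] at hx2
        exact hx2 ((memA _).1 hz).2
    · obtain ⟨z, hz, hzy⟩ := Finset.mem_image.1 hx'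
      have := ((memA _).1 hz).1
      rw [show n - φ i = z by omega] at hx3
      exact hx3 ((memA _).1 hz).2
  have hcard : A.card + A.card + A.card + (k - 1) ≤ n + 1 := by
    calc A.card + A.card + A.card + (k - 1)
        = (((A ∪ A.image (· + 1)) ∪ A.image (n - ·)) ∪ (Finset.range (k - 1)).image φ).card := by
          rw [Finset.card_union_of_disjoint dU, Finset.card_union_of_disjoint dABC,
            Finset.card_union_of_disjoint dAB, hB, hC, hU]
      _ ≤ (Finset.range (n + 1)).card := by
          refine Finset.card_le_card fun x hx => ?_
          simp only [Finset.mem_union, Finset.mem_image, Finset.mem_range, memA] at hx ⊢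
          rcases hx with ((⟨hx, -⟩ | ⟨y, ⟨hy, -⟩, rfl⟩) | ⟨y, -, rfl⟩) | ⟨i, hi, rfl⟩
          · omega
          · omega
          · omega
          · have := (hφspec i hi).2.1
            omega
      _ = n + 1 := Finset.card_range _
  have htop : ((Finset.range (n + 2 * k + 1)).filter (· ∈ H)).card ≤ A.card + k := by
    calc _ ≤ (A ∪ (Finset.range k).image (fun j => n + 2 * j + 1)).card := by
          refine Finset.card_le_card fun x hx => ?_
          simp only [Finset.mem_union, Finset.mem_image, Finset.mem_range, memA,
            Finset.mem_filter] at hx ⊢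
          obtain ⟨hx, hxH⟩ := hx
          by_cases hxn : x < n
          · exact Or.inl ⟨hxn, hxH⟩
          · right
            have hpar : (x - n) % 2 = 1 := by
              by_contra hc
              have := hgap ((x - n) / 2) (by omega)
              rw [show n + 2 * ((x - n) / 2) = x by omega] at this
              exact this hxH
            exact ⟨(x - n) / 2, by omega, by omega⟩
      _ ≤ A.card + ((Finset.range k).image (fun j => n + 2 * j + 1)).card :=
          Finset.card_union_le _ _
      _ ≤ A.card + k := by
          have := Finset.card_image_le (s := Finset.range k) (f := fun j => n + 2 * j + 1)
          rw [Finset.card_range] at this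
          omega
  omega

theorem ncard_compl_eq_card (hfin : Hᶜ.Finite) : Hᶜ.ncard = (hfin.toFinset).card :=
  Set.ncard_eq_toFinset_card _ hfin

theorem gap_notMem {g i : ℕ} (hH : IsNumericalSemigroupOfGenus H g) (hi : i < g) :
    gap H (i + 1) ∉ H := by
  obtain ⟨-, -, hfin, hcard⟩ := hH
  rw [ncard_compl_eq_card hfin] at hcard
  exact Nat.nth_mem (p := fun n => n ∉ H) i (fun hf => by
    rw [show hf.toFinset = hfin.toFinset by ext; simp, hcard]; exact hi)

theorem count_gap [DecidablePred fun n => n ∉ H] {g i : ℕ}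
    (hH : IsNumericalSemigroupOfGenus H g) (hi : i < g) :
    Nat.count (fun n => n ∉ H) (gap H (i + 1)) = i := by
  obtain ⟨-, -, hfin, hcard⟩ := hH
  rw [ncard_compl_eq_card hfin] at hcard
  exact Nat.count_nth (p := fun n => n ∉ H) (fun hf => by
    rw [show hf.toFinset = hfin.toFinset by ext; simp, hcard]; exact hi)

theorem mem_of_gap_lt {g x : ℕ} (hH : IsNumericalSemigroupOfGenus H g) (hg : 1 ≤ g)
    (hx : gap H g < x) : x ∈ H := by
  classical
  by_contra hc
  obtain ⟨i, rfl⟩ : ∃ i, g = i + 1 := ⟨g - 1, by omega⟩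
  have h1 := count_gap hH (Nat.lt_succ_self i)
  have h2 := gap_notMem hH (Nat.lt_succ_self i)
  have h3 : Nat.count (fun n => n ∉ H) (x + 1) ≤ i + 1 := by
    rw [Nat.count_eq_card_filter_range, ← hH.2.2.2, ncard_compl_eq_card hH.2.2.1]
    exact Finset.card_le_card fun y hy => by simpa using (Finset.mem_filter.1 hy).2
  have h4 : Nat.count (fun n => n ∉ H) (gap H (i + 1) + 1) = i + 1 := by
    rw [Nat.count_succ, h1, if_pos h2]
  have h5 : Nat.count (fun n => n ∉ H) (x + 1) = Nat.count (fun n => n ∉ H) x + 1 := by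
    rw [Nat.count_succ, if_pos hc]
  have h6 := Nat.count_monotone (fun n => n ∉ H) (show gap H (i + 1) + 1 ≤ x from hx)
  omega

/-- A sparse semigroup has no two consecutive elements below its Frobenius number. -/
theorem IsSparse.gap_lt_of_mem_of_succ_mem {g x : ℕ} (hs : IsSparse H g)
    (hH : IsNumericalSemigroupOfGenus H g) (hg : 1 ≤ g) (hx : x ∈ H) (hx1 : x + 1 ∈ H) :
    gap H g < x + 1 := by
  classical
  by_contra! hle
  obtain ⟨i, rfl⟩ : ∃ i, g = i + 1 := ⟨g - 1, by omega⟩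
  have hF := gap_notMem hH (Nat.lt_succ_self i)
  have hone : 1 ∉ H := fun h1 => hF <| by
    have hall : ∀ m, m ∈ H := fun m => by
      induction m with
      | zero => exact hH.1
      | succ m ih => exact hH.2.1 _ ih _ h1
    exact hall _
  have hx2 : 2 ≤ x := by
    by_contra hc
    have : x = 0 ∨ x = 1 := by omega
    rcases this with rfl | rfl
    · exact hone hx1
    · exact hone hx
  set c := Nat.count (fun n => n ∉ H) x with hc
  have hcpos : 1 ≤ c := by
    have h2 : Nat.count (fun n => n ∉ H) 2 ≤ c := Nat.count_monotone _ hx2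
    have : Nat.count (fun n => n ∉ H) 2 = Nat.count (fun n => n ∉ H) 1 + 1 := by
      rw [Nat.count_succ, if_pos hone]
    omega
  have hci : c ≤ i := by
    rw [← count_gap hH (Nat.lt_succ_self i)]
    exact Nat.count_monotone _ (by omega)
  have hlow : gap H c < x := Nat.nth_lt_of_lt_count (by omega)
  have hmem := gap_notMem hH (i := c) (by omega)
  have hhigh : x ≤ gap H (c + 1) := by
    by_contra! hlt
    have h1 := count_gap hH (i := c) (by omega)
    have h2 : Nat.count (fun n => n ∉ H) (gap H (c + 1) + 1) ≤ c := Nat.count_monotone _ hlt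
    rw [Nat.count_succ, if_pos hmem] at h2
    omega
  have hne : gap H (c + 1) ≠ x := fun he => hmem (he ▸ hx)
  have hne' : gap H (c + 1) ≠ x + 1 := fun he => hmem (he ▸ hx1)
  have := hs c hcpos (by omega)
  omega

theorem card_filter_mem_add_genus [DecidablePred (· ∈ H)] {g : ℕ}
    (hH : IsNumericalSemigroupOfGenus H g) (hg : 1 ≤ g) :
    ((Finset.range (gap H g + 1)).filter (· ∈ H)).card + g = gap H g + 1 := by
  have hsplit := Finset.card_filter_add_card_filter_not
    (s := Finset.range (gap H g + 1)) (· ∈ H)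
  have hgaps : ((Finset.range (gap H g + 1)).filter (fun x => ¬ x ∈ H)).card = g := by
    refine Eq.trans ?_ ((ncard_compl_eq_card hH.2.2.1).symm.trans hH.2.2.2)
    congr 1
    ext x
    simp only [Finset.mem_filter, Finset.mem_range, Set.Finite.mem_toFinset, Set.mem_compl_iff,
      and_iff_right_iff_imp]
    intro hx
    by_contra hc
    exact hx (mem_of_gap_lt hH hg (by omega))
  rw [Finset.card_range] at hsplit
  omega

theorem even_of_mem_of_lt_gap {g r x : ℕ} (hH : IsNumericalSemigroupOfGenus H g)
    (hs : IsSparse H g) (hF : gap H g = 2 * g - 2 * r - 1) (hg : 4 * r + 1 < g)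
    (hx : x ∈ H) (hlt : x < gap H g) : x % 2 = 0 := by
  classical
  by_contra hodd
  have hl : gap H g ∉ H := by
    have := gap_notMem hH (i := g - 1) (by omega)
    rwa [Nat.sub_add_cancel (by omega)] at this
  have h1 := three_mul_card_le_of_odd_mem hH.2.1 hl (by omega)
    (fun y => hs.gap_lt_of_mem_of_succ_mem hH (by omega)) ⟨x, hx, by omega, hlt⟩
  have h2 := card_filter_mem_add_genus hH (by omega)
  omega

end

/-- **Corollary.** Let `H` be a sparse numerical semigroup of genus `g` with odd
Frobenius number `ℓ_g = 2g - 2r - 1` such that `g > 4r + 1`. Then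
`H = 2H' ∪ H_{2g-2r-1} = {2n : n ∈ H'} ∪ {m : m ≥ 2g - 2r}`, where
`H' := {n : 2n ∈ H, 2n < ℓ_g} ∪ {n : 2n > ℓ_g}` is a numerical semigroup of
genus `r`. -/
theorem charact_large_genus_odd_frobenius (H : Set ℕ) (g r : ℕ)
    (hH : IsNumericalSemigroupOfGenus H g) (hs : IsSparse H g)
    (hF : gap H g = 2 * g - 2 * r - 1) (hg : 4 * r + 1 < g) :
    IsNumericalSemigroupOfGenus
      ({n : ℕ | 2 * n ∈ H ∧ 2 * n < gap H g} ∪ {n : ℕ | gap H g < 2 * n}) r ∧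
    H = {n : ℕ | ∃ m ∈ ({n : ℕ | 2 * n ∈ H ∧ 2 * n < gap H g} ∪
            {n : ℕ | gap H g < 2 * n}), n = 2 * m} ∪
        {m : ℕ | 2 * g - 2 * r ≤ m} := by
  have hl : gap H g ∉ H := by
    have := gap_notMem hH (i := g - 1) (by omega)
    rwa [Nat.sub_add_cancel (by omega)] at this
  have hbig : ∀ x, gap H g < x → x ∈ H := fun x => mem_of_gap_lt hH (by omega)
  have heven : ∀ x ∈ H, x < gap H g → x % 2 = 0 :=
    fun x hx => even_of_mem_of_lt_gap hH hs hF hg hx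
  have hH' : {n : ℕ | 2 * n ∈ H ∧ 2 * n < gap H g} ∪ {n : ℕ | gap H g < 2 * n} =
      {n : ℕ | 2 * n ∈ H} := by
    ext n
    simp only [Set.mem_union, Set.mem_ofPred_eq]
    refine ⟨fun hn => hn.elim (·.1) (hbig _), fun hn => ?_⟩
    rcases lt_or_ge (2 * n) (gap H g) with h | h
    · exact Or.inl ⟨hn, h⟩
    · exact Or.inr (by omega)
  rw [hH']
  have hinj : Function.Injective (fun n : ℕ => 2 * n) := fun a b hab => by
    simp only at hab
    omega
  have hfin : {n : ℕ | 2 * n ∈ H}ᶜ.Finite :=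
    hH.2.2.1.preimage (f := fun n => 2 * n) hinj.injOn
  refine ⟨⟨hH.1, fun a ha b hb => ?_, hfin, ?_⟩, ?_⟩
  · have := hH.2.1 _ ha _ hb
    rwa [← mul_add] at this
  · have hsplit : Hᶜ = (fun n => 2 * n) '' {n : ℕ | 2 * n ∈ H}ᶜ ∪
        (fun n => 2 * n + 1) '' (Finset.range (g - r) : Set ℕ) := by
      ext x
      simp only [Set.mem_union, Set.mem_image, Set.mem_compl_iff, Set.mem_ofPred_eq,
        Finset.coe_range, Set.mem_Iio]
      constructor
      · intro hx
        have hxl : x ≤ gap H g := by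
          by_contra hc
          exact hx (hbig x (by omega))
        rcases Nat.mod_two_eq_zero_or_one x with h | h
        · exact Or.inl ⟨x / 2, by rwa [show 2 * (x / 2) = x by omega], by omega⟩
        · exact Or.inr ⟨x / 2, by omega, by omega⟩
      · rintro (⟨y, hy, rfl⟩ | ⟨y, hy, rfl⟩) hx
        · exact hy hx
        · rcases (show 2 * y + 1 ≤ gap H g by omega).lt_or_eq with h | h
          · have := heven _ hx h
            omega
          · exact hl (h ▸ hx)
    have hdisj : Disjoint ((fun n => 2 * n) '' {n : ℕ | 2 * n ∈ H}ᶜ)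
        ((fun n => 2 * n + 1) '' (Finset.range (g - r) : Set ℕ)) := by
      rw [Set.disjoint_left]
      rintro _ ⟨y, -, rfl⟩ ⟨z, -, hz⟩
      change 2 * z + 1 = 2 * y at hz
      omega
    have hcard := hH.2.2.2
    rw [hsplit, Set.ncard_union_eq hdisj (hfin.image _) ((Finset.finite_toSet _).image _),
      Set.ncard_image_of_injective _ hinj, Set.ncard_image_of_injective _ (fun a b hab => by
        change 2 * a + 1 = 2 * b + 1 at hab
        omega), Set.ncard_coe_finset, Finset.card_range] at hcard
    omega
  · ext x
    simp only [Set.mem_union, Set.mem_ofPred_eq]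
    constructor
    · intro hx
      by_cases hxl : x < gap H g
      · have := heven x hx hxl
        exact Or.inl ⟨x / 2, by rwa [show 2 * (x / 2) = x by omega], by omega⟩
      · have : x ≠ gap H g := fun h => hl (h ▸ hx)
        exact Or.inr (by omega)
    · rintro (⟨m, hm, rfl⟩ | hx)
      · exact hm
      · exact hbig x (by omega)
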